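/- Let q be a positive rational and suppose (a,b,c) are positive rationals with a² + b² = c² and a·b = 2q. Then the point (x, y) = (q(a+c)/b, 2q²(a+c)/b²) satisfies y² = x³ − q²x and y ≠ 0. -/

import Mathlib

theorem triangle_to_elliptic_point (q a b c : ℚ) (hq : 0 < q)
    (ha : 0 < a) (hb : 0 < b) (hc : 0 < c)
    (hpyth : a^2 + b^2 = c^2) (harea : a * b = 2 * q) :
    (2 * q^2 * (a + c) / b^2)^2
      = (q * (a + c) / b)^3 - q^2 * (q * (a + c) / b) ∧
    2 * q^2 * (a + c) / b^2 ≠ 0 := by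
  have hb' : b ≠ 0 := hb.ne'
  refine ⟨?_, by positivity⟩
  have h : (a + c)^2 - b^2 = 2 * a * (a + c) := by linear_combination -hpyth
  have h1 : (q * (a + c) / b)^3 - q^2 * (q * (a + c) / b)
      = q^3 * (a + c) * ((a + c)^2 - b^2) / b^3 := by
    field_simp
  have h2 : (2 * q^2 * (a + c) / b^2)^2 = 2 * q^3 * (a + c)^2 * (2 * q) / b^4 := by
    ring
  rw [h1, h, h2, ← harea]
  field_simp
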